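/- Suppose the exponential family is minimal and let θ* denote the inverse of the bijection ∇A : ℝ^I → M°, where M° is the interior of the set of realizable mean parameters. Then θ* is continuously differentiable on M°. -/

import Mathlib

/-- The log-partition function `A(θ) = log Σ_{x∈X} exp⟨θ, φ(x)⟩`. -/
noncomputable def logPartition {X I : Type*} [Fintype X] [Fintype I]
    (φ : X → I → ℝ) (θ : I → ℝ) : ℝ :=
  Real.log (∑ x : X, Real.exp (∑ α : I, θ α * φ x α))

/-- The exponential-family density `p_θ(x) = exp(⟨θ, φ(x)⟩ − A(θ))`. -/
noncomputable def expDensity {X I : Type*} [Fintype X] [Fintype I]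
    (φ : X → I → ℝ) (θ : I → ℝ) (x : X) : ℝ :=
  Real.exp ((∑ α : I, θ α * φ x α) - logPartition φ θ)

/-- The forward map `θ ↦ ∇A(θ) = (E_θ[φ_α(X)])_{α∈I}`. -/
noncomputable def forwardMap {X I : Type*} [Fintype X] [Fintype I]
    (φ : X → I → ℝ) (θ : I → ℝ) : I → ℝ :=
  fun α => ∑ x : X, φ x α * expDensity φ θ x

/-- The set `M_φ` of realizable mean parameters. -/
def meanParamSet {X I : Type*} [Fintype X] [Fintype I] (φ : X → I → ℝ) : Set (I → ℝ) :=
  {μ | ∃ q : X → ℝ, (∀ x, 0 ≤ q x) ∧ (∑ x : X, q x = 1) ∧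
    ∀ α : I, μ α = ∑ x : X, φ x α * q x}

/-- Minimality: no nonzero `a ∈ ℝ^I` and constant `c` satisfy
`⟨a, φ(x)⟩ = c` for all `x ∈ X`. -/
def MinimalFamily {X I : Type*} [Fintype I] (φ : X → I → ℝ) : Prop :=
  ¬ ∃ a : I → ℝ, a ≠ 0 ∧ ∃ c : ℝ, ∀ x : X, ∑ α : I, a α * φ x α = c

section ExponentialFamily

variable {X I : Type*} [Fintype I] (φ : X → I → ℝ)

/-- The pairing `θ ↦ ⟨θ, φ(x)⟩` as a continuous linear functional. -/
noncomputable def potentialPairing (x : X) : (I → ℝ) →L[ℝ] ℝ :=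
  ∑ α : I, φ x α • ContinuousLinearMap.proj α

theorem potentialPairing_apply (x : X) (θ : I → ℝ) :
    potentialPairing φ x θ = ∑ α : I, θ α * φ x α := by
  simp [potentialPairing, mul_comm]

theorem MinimalFamily.eq_zero {φ : X → I → ℝ} (hmin : MinimalFamily φ) {v : I → ℝ} {c : ℝ}
    (h : ∀ x, potentialPairing φ x v = c) : v = 0 := by
  by_contra hv
  exact hmin ⟨v, hv, c, fun x => by rw [← potentialPairing_apply, h]⟩

variable [Fintype X]

theorem logPartition_eq (θ : I → ℝ) :
    logPartition φ θ = Real.log (∑ x : X, Real.exp (potentialPairing φ x θ)) := by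
  simp only [logPartition, potentialPairing_apply]

theorem expDensity_eq (θ : I → ℝ) (x : X) :
    expDensity φ θ x = Real.exp (potentialPairing φ x θ - logPartition φ θ) := by
  simp only [expDensity, potentialPairing_apply]

theorem expDensity_pos (θ : I → ℝ) (x : X) : 0 < expDensity φ θ x :=
  Real.exp_pos _

theorem sum_mul_forwardMap (θ v : I → ℝ) :
    ∑ α, v α * forwardMap φ θ α = ∑ x, expDensity φ θ x * potentialPairing φ x v := by
  simp only [forwardMap, potentialPairing_apply, Finset.mul_sum]
  rw [Finset.sum_comm]
  exact Finset.sum_congr rfl fun x _ => Finset.sum_congr rfl fun α _ => by ring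

variable [Nonempty X]

theorem sum_exp_potentialPairing_pos (θ : I → ℝ) :
    0 < ∑ x : X, Real.exp (potentialPairing φ x θ) :=
  Finset.sum_pos (fun _ _ => Real.exp_pos _) Finset.univ_nonempty

theorem expDensity_eq_div (θ : I → ℝ) (x : X) :
    expDensity φ θ x =
      Real.exp (potentialPairing φ x θ) / ∑ y : X, Real.exp (potentialPairing φ y θ) := by
  rw [expDensity_eq, logPartition_eq, Real.exp_sub,
    Real.exp_log (sum_exp_potentialPairing_pos φ θ)]

theorem sum_expDensity (θ : I → ℝ) : ∑ x, expDensity φ θ x = 1 := by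
  simp only [expDensity_eq_div, ← Finset.sum_div]
  exact div_self (sum_exp_potentialPairing_pos φ θ).ne'

theorem potentialPairing_le_logPartition (θ : I → ℝ) (x : X) :
    potentialPairing φ x θ ≤ logPartition φ θ := by
  rw [logPartition_eq, Real.le_log_iff_exp_le (sum_exp_potentialPairing_pos φ θ)]
  exact Finset.single_le_sum (f := fun y => Real.exp (potentialPairing φ y θ))
    (fun _ _ => (Real.exp_pos _).le) (Finset.mem_univ x)

theorem contDiff_logPartition {n : WithTop ℕ∞} : ContDiff ℝ n (logPartition φ) := by
  have h : logPartition φ =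
      fun θ => Real.log (∑ x : X, Real.exp (potentialPairing φ x θ)) :=
    funext (logPartition_eq φ)
  rw [h]
  refine ContDiff.log (ContDiff.sum fun x _ => ?_)
    fun θ => (sum_exp_potentialPairing_pos φ θ).ne'
  exact (potentialPairing φ x).contDiff.exp

theorem hasFDerivAt_logPartition (θ : I → ℝ) :
    HasFDerivAt (logPartition φ) (∑ x, expDensity φ θ x • potentialPairing φ x) θ := by
  have h : logPartition φ =
      fun θ => Real.log (∑ x : X, Real.exp (potentialPairing φ x θ)) :=
    funext (logPartition_eq φ)
  rw [h]
  have hsum : HasFDerivAt (fun θ => ∑ x : X, Real.exp (potentialPairing φ x θ))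
      (∑ x, Real.exp (potentialPairing φ x θ) • potentialPairing φ x) θ :=
    HasFDerivAt.fun_sum fun x _ => (potentialPairing φ x).hasFDerivAt.exp
  refine (hsum.log (sum_exp_potentialPairing_pos φ θ).ne').congr_fderiv ?_
  rw [Finset.smul_sum]
  refine Finset.sum_congr rfl fun x _ => ?_
  rw [smul_smul, expDensity_eq_div, div_eq_inv_mul]

theorem contDiff_expDensity {n : WithTop ℕ∞} (x : X) :
    ContDiff ℝ n fun θ => expDensity φ θ x := by
  simp only [expDensity_eq]
  exact ((potentialPairing φ x).contDiff.sub (contDiff_logPartition φ)).exp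

theorem hasFDerivAt_expDensity (θ : I → ℝ) (x : X) :
    HasFDerivAt (fun θ => expDensity φ θ x)
      (expDensity φ θ x •
        (potentialPairing φ x - ∑ y, expDensity φ θ y • potentialPairing φ y)) θ := by
  have h := ((potentialPairing φ x).hasFDerivAt.sub (hasFDerivAt_logPartition φ θ)).exp
  simpa only [expDensity_eq, Pi.sub_apply] using h

theorem contDiff_forwardMap {n : WithTop ℕ∞} : ContDiff ℝ n (forwardMap φ) :=
  contDiff_pi.2 fun _ => ContDiff.sum fun x _ => contDiff_const.mul (contDiff_expDensity φ x)

/-- The derivative of `∇A` at `θ`, that is, the covariance of the potentials under `p_θ`. -/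
noncomputable def covarianceMap (θ : I → ℝ) : (I → ℝ) →L[ℝ] (I → ℝ) :=
  ContinuousLinearMap.pi fun α => ∑ x, φ x α • (expDensity φ θ x •
    (potentialPairing φ x - ∑ y, expDensity φ θ y • potentialPairing φ y))

theorem hasFDerivAt_forwardMap (θ : I → ℝ) :
    HasFDerivAt (forwardMap φ) (covarianceMap φ θ) θ :=
  hasFDerivAt_pi.2 fun α => HasFDerivAt.fun_sum fun x _ =>
    (hasFDerivAt_expDensity φ θ x).const_mul (φ x α)

/-- The quadratic form of the covariance is the variance of `⟨v, φ(X)⟩`. -/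
theorem sum_mul_covarianceMap (θ v : I → ℝ) :
    ∑ α, v α * covarianceMap φ θ v α = ∑ x, expDensity φ θ x *
      (potentialPairing φ x v - ∑ y, expDensity φ θ y * potentialPairing φ y v) ^ 2 := by
  set m := ∑ y, expDensity φ θ y * potentialPairing φ y v with hm
  have hcov (α : I) : covarianceMap φ θ v α =
      ∑ x, φ x α * (expDensity φ θ x * (potentialPairing φ x v - m)) := by
    simp [covarianceMap, sum_apply, hm]
  have hcentered : ∑ x, expDensity φ θ x * (potentialPairing φ x v - m) = 0 := by
    simp only [mul_sub, Finset.sum_sub_distrib, ← Finset.sum_mul, sum_expDensity, ← hm]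
    ring
  calc ∑ α, v α * covarianceMap φ θ v α
      = ∑ x, potentialPairing φ x v *
          (expDensity φ θ x * (potentialPairing φ x v - m)) := by
        simp only [hcov, Finset.mul_sum]
        rw [Finset.sum_comm]
        refine Finset.sum_congr rfl fun x _ => ?_
        rw [potentialPairing_apply φ x v, Finset.sum_mul]
        exact Finset.sum_congr rfl fun α _ => by ring
    _ = ∑ x, potentialPairing φ x v *
          (expDensity φ θ x * (potentialPairing φ x v - m)) -
          m * ∑ x, expDensity φ θ x * (potentialPairing φ x v - m) := by
        rw [hcentered]; ring
    _ = _ := by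
        rw [Finset.mul_sum, ← Finset.sum_sub_distrib]
        exact Finset.sum_congr rfl fun x _ => by ring

variable {φ}

theorem MinimalFamily.covarianceMap_injective (hmin : MinimalFamily φ) (θ : I → ℝ) :
    Function.Injective (covarianceMap φ θ) := by
  refine (injective_iff_map_eq_zero _).2 fun v hv => ?_
  have h := sum_mul_covarianceMap φ θ v
  simp only [hv, Pi.zero_apply, mul_zero, Finset.sum_const_zero] at h
  have h' := (Finset.sum_eq_zero_iff_of_nonneg fun x _ =>
    mul_nonneg (expDensity_pos φ θ x).le (sq_nonneg _)).1 h.symm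
  refine hmin.eq_zero (c := ∑ y, expDensity φ θ y * potentialPairing φ y v) fun x => ?_
  have hx := h' x (Finset.mem_univ x)
  exact sub_eq_zero.1 (pow_eq_zero_iff two_ne_zero |>.1
    ((mul_eq_zero.1 hx).resolve_left (expDensity_pos φ θ x).ne'))

theorem MinimalFamily.forwardMap_injective (hmin : MinimalFamily φ) :
    Function.Injective (forwardMap φ) := by
  intro θ η h
  let u (ζ : I → ℝ) (x : X) : ℝ := potentialPairing φ x ζ - logPartition φ ζ
  have hterm (x : X) : 0 ≤ (expDensity φ θ x - expDensity φ η x) * (u θ x - u η x) := by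
    simp only [expDensity_eq]
    rcases le_total (u θ x) (u η x) with hle | hle
    · exact mul_nonneg_of_nonpos_of_nonpos
        (sub_nonpos.2 (Real.exp_le_exp.2 hle)) (sub_nonpos.2 hle)
    · exact mul_nonneg (sub_nonneg.2 (Real.exp_le_exp.2 hle)) (sub_nonneg.2 hle)
  have hpair : ∑ x, (expDensity φ θ x - expDensity φ η x) * potentialPairing φ x (θ - η) = 0 := by
    simp only [sub_mul, Finset.sum_sub_distrib, ← sum_mul_forwardMap, h, sub_self]
  have hsum : ∑ x, (expDensity φ θ x - expDensity φ η x) * (u θ x - u η x) = 0 := by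
    have hu (x : X) : u θ x - u η x =
        potentialPairing φ x (θ - η) - (logPartition φ θ - logPartition φ η) := by
      simp only [u, map_sub]; ring
    simp only [hu, mul_sub _ (potentialPairing φ _ _), Finset.sum_sub_distrib, hpair,
      ← Finset.sum_mul, sum_expDensity]
    ring
  have hzero := (Finset.sum_eq_zero_iff_of_nonneg fun x _ => hterm x).1 hsum
  refine sub_eq_zero.1 (hmin.eq_zero (c := logPartition φ θ - logPartition φ η) fun x => ?_)
  have hux : u θ x = u η x := by
    rcases mul_eq_zero.1 (hzero x (Finset.mem_univ x)) with hx | hx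
    · simp only [expDensity_eq] at hx
      exact Real.exp_injective (sub_eq_zero.1 hx)
    · exact sub_eq_zero.1 hx
  simp only [u] at hux
  rw [map_sub]
  linarith

theorem sum_mul_le_logPartition {μ : I → ℝ} (hμ : μ ∈ meanParamSet φ) (θ : I → ℝ) :
    ∑ α, θ α * μ α ≤ logPartition φ θ := by
  obtain ⟨q, hq, hq1, hqμ⟩ := hμ
  calc ∑ α, θ α * μ α = ∑ x, q x * potentialPairing φ x θ := by
        simp only [hqμ, potentialPairing_apply, Finset.mul_sum]
        rw [Finset.sum_comm]
        exact Finset.sum_congr rfl fun x _ => Finset.sum_congr rfl fun α _ => by ring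
    _ ≤ ∑ x, q x * logPartition φ θ :=
        Finset.sum_le_sum fun x _ =>
          mul_le_mul_of_nonneg_left (potentialPairing_le_logPartition φ θ x) (hq x)
    _ = logPartition φ θ := by rw [← Finset.sum_mul, hq1, one_mul]

/-- At an interior mean parameter the dual objective `A(θ) − ⟨θ, μ⟩` grows linearly. -/
theorem exists_mul_norm_le_logPartition_sub {μ : I → ℝ}
    (hμ : μ ∈ interior (meanParamSet φ)) :
    ∃ ε > 0, ∀ θ : I → ℝ, ε * ‖θ‖ ≤ logPartition φ θ - ∑ α, θ α * μ α := by
  obtain ⟨ε, hε, hball⟩ :=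
    Metric.nhds_basis_closedBall.mem_iff.1 (mem_interior_iff_mem_nhds.1 hμ)
  refine ⟨ε, hε, fun θ => ?_⟩
  let s : I → ℝ := fun α => SignType.sign (θ α)
  have hs : ‖s‖ ≤ 1 := (pi_norm_le_iff_of_nonneg zero_le_one).2 fun α => by
    rcases lt_trichotomy (θ α) 0 with h | h | h <;> simp [s, h]
  have hmem : μ + ε • s ∈ meanParamSet φ := hball <| by
    rw [mem_closedBall_iff_norm, add_sub_cancel_left, norm_smul, Real.norm_of_nonneg hε.le]
    exact mul_le_of_le_one_right hε.le hs
  have h := sum_mul_le_logPartition hmem θ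
  have hexpand : ∑ α, θ α * (μ + ε • s) α = ∑ α, θ α * μ α + ε * ∑ α, |θ α| := by
    rw [Finset.mul_sum, ← Finset.sum_add_distrib]
    refine Finset.sum_congr rfl fun α _ => ?_
    simp only [Pi.add_apply, Pi.smul_apply, smul_eq_mul, s]
    rw [← self_mul_sign (θ α)]
    ring
  have hnorm : ‖θ‖ ≤ ∑ α, |θ α| := (pi_norm_le_iff_of_nonneg
    (Finset.sum_nonneg fun _ _ => abs_nonneg _)).2 fun α =>
      Finset.single_le_sum (f := fun α => |θ α|) (fun _ _ => abs_nonneg _) (Finset.mem_univ α)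
  have := mul_le_mul_of_nonneg_left hnorm hε.le
  linarith

theorem exists_forwardMap_eq {μ : I → ℝ} (hμ : μ ∈ interior (meanParamSet φ)) :
    ∃ θ, forwardMap φ θ = μ := by
  classical
  obtain ⟨ε, hε, hbound⟩ := exists_mul_norm_le_logPartition_sub hμ
  let L : (I → ℝ) →L[ℝ] ℝ := ∑ α : I, μ α • ContinuousLinearMap.proj α
  have hL (θ : I → ℝ) : L θ = ∑ α, θ α * μ α := by
    simp [L, sum_apply, mul_comm]
  have htendsto : Filter.Tendsto (fun θ => logPartition φ θ - L θ)
      (Filter.cocompact (I → ℝ)) Filter.atTop :=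
    Filter.tendsto_atTop_mono (fun θ => by rw [hL]; exact hbound θ)
      ((tendsto_norm_cocompact_atTop (E := I → ℝ)).const_mul_atTop hε)
  obtain ⟨θ, hθ⟩ := Continuous.exists_forall_le
    ((contDiff_logPartition φ (n := 0)).continuous.sub L.continuous) htendsto
  have hmin : IsLocalMin (fun θ => logPartition φ θ - L θ) θ := Filter.Eventually.of_forall hθ
  have hzero := hmin.hasFDerivAt_eq_zero ((hasFDerivAt_logPartition φ θ).sub L.hasFDerivAt)
  refine ⟨θ, funext fun α => ?_⟩
  have h := DFunLike.congr_fun hzero (Pi.single α 1)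
  simp only [sub_apply, sum_apply,
    smul_apply, smul_eq_mul, ← sum_mul_forwardMap, hL,
    zero_apply] at h
  simpa [Pi.single_apply, sub_eq_zero] using h

theorem MinimalFamily.contDiffAt_of_leftInverse (hmin : MinimalFamily φ)
    {g : (I → ℝ) → I → ℝ} (hg : Function.LeftInverse g (forwardMap φ)) (θ : I → ℝ) :
    ContDiffAt ℝ 1 g (forwardMap φ θ) := by
  let e : (I → ℝ) ≃L[ℝ] (I → ℝ) := (LinearEquiv.ofInjectiveEndo
    (covarianceMap φ θ : (I → ℝ) →ₗ[ℝ] (I → ℝ))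
    (hmin.covarianceMap_injective θ)).toContinuousLinearEquiv
  have hF : ContDiffAt ℝ 1 (forwardMap φ) θ := (contDiff_forwardMap φ).contDiffAt
  have he : HasFDerivAt (forwardMap φ) (e : (I → ℝ) →L[ℝ] (I → ℝ)) θ :=
    hasFDerivAt_forwardMap φ θ
  refine (hF.to_localInverse he one_ne_zero).congr_of_eventuallyEq ?_
  filter_upwards [(hF.hasStrictFDerivAt' he one_ne_zero).eventually_right_inverse] with μ hμ
  exact (congrArg g hμ.symm).trans (hg _)

end ExponentialFamily

/-- If the family is minimal, the inverse `θ*` of the bijection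
`∇A : ℝ^I → M°` (where `M°` is the interior of the set of realizable mean
parameters) exists and is continuously differentiable on `M°`. -/
theorem minimal_inverse_forwardMap_contDiffOn
    {X I : Type*} [Fintype X] [Nonempty X] [Fintype I]
    (φ : X → I → ℝ) (hmin : MinimalFamily φ) :
    ∃ θstar : (I → ℝ) → (I → ℝ),
      (∀ θ : I → ℝ, θstar (forwardMap φ θ) = θ) ∧
      (∀ μ ∈ interior (meanParamSet φ), forwardMap φ (θstar μ) = μ) ∧
      ContDiffOn ℝ 1 θstar (interior (meanParamSet φ)) := by
  have hleft := Function.leftInverse_invFun hmin.forwardMap_injective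
  refine ⟨Function.invFun (forwardMap φ), hleft,
    fun μ hμ => Function.invFun_eq (exists_forwardMap_eq hμ), fun μ hμ => ?_⟩
  obtain ⟨θ, rfl⟩ := exists_forwardMap_eq hμ
  exact (hmin.contDiffAt_of_leftInverse hleft θ).contDiffWithinAt
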